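/- arXiv:1603.02295 — 2 statements merged into one kernel-verified Lean document; each statement's English description precedes it below -/
import Mathlib

section
/- Let R > 0 and let l > 0 satisfy J₁(l) = 0. Define u(η) = (1/ρ(η)) · J₁(l·ρ(η)/R) on B(0,R) ∖ {0}. Then ∫_{B(0,R)} ((Xu)² + (Yu)²) dv = (l²/R²) · ∫_{B(0,R)} ψ · u² dv, where ψ(x,y,t) = (x²+y²)/ρ(x,y,t)². -/
open MeasureTheory Real Set

noncomputable section

/-- The underlying space of the Heisenberg group ℍ¹: ℝ³ with coordinates (x, y, t). -/
abbrev H1 : Type := ℝ × ℝ × ℝ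

/-- The Koranyi norm ρ(x,y,t) = ((x²+y²)² + t²)^{1/4}. -/
def ρH (η : H1) : ℝ := ((η.1 ^ 2 + η.2.1 ^ 2) ^ 2 + η.2.2 ^ 2) ^ ((1 : ℝ) / 4)

/-- The Heisenberg group law: η∘ξ = (x+x₀, y+y₀, t+t₀+2(x₀y − x y₀)). -/
def hmul (η ξ : H1) : H1 :=
  (η.1 + ξ.1, η.2.1 + ξ.2.1, η.2.2 + ξ.2.2 + 2 * (ξ.1 * η.2.1 - η.1 * ξ.2.1))

/-- The Heisenberg group inverse: ξ⁻¹ = (−x₀,−y₀,−t₀). -/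
def hinv (ξ : H1) : H1 := (-ξ.1, -ξ.2.1, -ξ.2.2)

/-- The Koranyi distance d(ξ,η) = ρ(ξ⁻¹∘η). -/
def kd (ξ η : H1) : ℝ := ρH (hmul (hinv ξ) η)

/-- The Koranyi ball B(ξ,r) = {η : d(ξ,η) < r}. -/
def kball (ξ : H1) (r : ℝ) : Set H1 := {η | kd ξ η < r}

/-- Horizontal derivative Xu = ∂u/∂x + 2y·∂u/∂t, as the derivative along (1,0,2y). -/
def Xd (u : H1 → ℝ) (η : H1) : ℝ := fderiv ℝ u η (1, 0, 2 * η.2.1)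

/-- Horizontal derivative Yu = ∂u/∂y − 2x·∂u/∂t, as the derivative along (0,1,−2x). -/
def Yd (u : H1 → ℝ) (η : H1) : ℝ := fderiv ℝ u η (0, 1, -2 * η.1)

/-- The Kohn-Laplacian Δ_ℍ u = X(Xu) + Y(Yu). -/
def kohn (u : H1 → ℝ) (η : H1) : ℝ := Xd (Xd u) η + Yd (Yd u) η

/-- The fundamental solution with pole ξ: Γ_ξ(η) = 1/(8π d(ξ,η)²). -/
def Γξ (ξ η : H1) : ℝ := 1 / (8 * π * kd ξ η ^ 2)

/-- A set A satisfies the uniform exterior ball property if there exists r₀ > 0 such that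
for every ζ ∈ ∂A and every r ∈ (0,r₀] there exists η with B(η,r) ∩ A = ∅ and ζ ∈ ∂B(η,r). -/
def uebp (A : Set H1) : Prop :=
  ∃ r₀ > (0 : ℝ), ∀ ζ ∈ frontier A, ∀ r : ℝ, 0 < r → r ≤ r₀ →
    ∃ η : H1, kball η r ∩ A = ∅ ∧ ζ ∈ frontier (kball η r)

/-- Ω has C¹ boundary: it is the sublevel set of a C¹ defining function with
nonvanishing gradient on the boundary. -/
def c1Bdry (Ω : Set H1) : Prop :=
  ∃ f : H1 → ℝ, ContDiff ℝ 1 f ∧ Ω = {x | f x < 0} ∧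
    frontier Ω = {x | f x = 0} ∧ ∀ x ∈ frontier Ω, fderiv ℝ f x ≠ 0

/-- Ω has smooth boundary: it is the sublevel set of a smooth defining function with
nonvanishing gradient on the boundary. -/
def smoothBdry (Ω : Set H1) : Prop :=
  ∃ f : H1 → ℝ, ContDiff ℝ (⊤ : ℕ∞) f ∧ Ω = {x | f x < 0} ∧
    frontier Ω = {x | f x = 0} ∧ ∀ x ∈ frontier Ω, fderiv ℝ f x ≠ 0

/-- The horizontal perimeter of Ω:
P_ℍ(Ω) = sup { ∫_Ω (Xa + Yb) : a,b of class C¹ with a²+b² ≤ 1 }. -/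
def horizPerim (Ω : Set H1) : ℝ :=
  sSup { p : ℝ | ∃ a b : H1 → ℝ, ContDiff ℝ 1 a ∧ ContDiff ℝ 1 b ∧
    (∀ η, a η ^ 2 + b η ^ 2 ≤ 1) ∧ p = ∫ η in Ω, (Xd a η + Yd b η) }

/-- The first Dirichlet eigenvalue of the Kohn-Laplacian on Ω, via the Rayleigh quotient. -/
def lam1 (Ω : Set H1) : ℝ :=
  sInf { q : ℝ | ∃ v : H1 → ℝ, ContDiff ℝ (⊤ : ℕ∞) v ∧ HasCompactSupport v ∧ tsupport v ⊆ Ω ∧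
    v ≠ 0 ∧ q = (∫ η in Ω, ((Xd v η) ^ 2 + (Yd v η) ^ 2)) / (∫ η in Ω, (v η) ^ 2) }

/-- The Bessel function of the first kind of order 1,
J₁(l) = (l/2)·Σ_{k=0}^∞ ((−1)^k/(k!·(k+1)!))·(l/2)^{2k}. -/
def J1 (l : ℝ) : ℝ :=
  (l / 2) * ∑' k : ℕ,
    ((-1 : ℝ) ^ k / ((Nat.factorial k : ℝ) * (Nat.factorial (k + 1) : ℝ))) * (l / 2) ^ (2 * k)

/-- The entire function `∑ (-z)^k / (k! (k+n)!)`, a rescaled Bessel function of order `n`. -/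
def besselSeries (n : ℕ) (z : ℝ) : ℝ :=
  ∑' k : ℕ, ((-1 : ℝ) ^ k / ((Nat.factorial k : ℝ) * (Nat.factorial (k + n) : ℝ))) * z ^ k

lemma abs_besselSeries_term_le (n k : ℕ) (z : ℝ) :
    |((-1 : ℝ) ^ k / ((Nat.factorial k : ℝ) * (Nat.factorial (k + n) : ℝ))) * z ^ k| ≤
      |z| ^ k / (Nat.factorial k : ℝ) := by
  have h1 : (1 : ℝ) ≤ (Nat.factorial (k + n) : ℝ) := by exact_mod_cast Nat.factorial_pos _
  have h0 : (0 : ℝ) < (Nat.factorial k : ℝ) := by exact_mod_cast Nat.factorial_pos _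
  rw [abs_mul, abs_div, abs_pow, abs_pow, abs_neg, abs_one, one_pow, abs_of_pos (by positivity),
    div_mul_eq_mul_div, one_mul]
  gcongr
  nlinarith

lemma summable_besselSeries (n : ℕ) (z : ℝ) :
    Summable fun k : ℕ =>
      ((-1 : ℝ) ^ k / ((Nat.factorial k : ℝ) * (Nat.factorial (k + n) : ℝ))) * z ^ k :=
  Summable.of_norm_bounded (Real.summable_pow_div_factorial |z|)
    fun k => abs_besselSeries_term_le n k z

lemma besselSeries_derivTerm (n k : ℕ) (z : ℝ) :
    ((-1 : ℝ) ^ (k + 1) / ((Nat.factorial (k + 1) : ℝ) * (Nat.factorial (k + 1 + n) : ℝ))) *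
        (((k + 1 : ℕ) : ℝ) * z ^ k) =
      -(((-1 : ℝ) ^ k / ((Nat.factorial k : ℝ) * (Nat.factorial (k + (n + 1)) : ℝ))) * z ^ k) := by
  have h0 : (Nat.factorial k : ℝ) ≠ 0 := by exact_mod_cast Nat.factorial_ne_zero _
  have h1 : (Nat.factorial (k + (n + 1)) : ℝ) ≠ 0 := by exact_mod_cast Nat.factorial_ne_zero _
  rw [show k + 1 + n = k + (n + 1) by ring, Nat.factorial_succ k]
  push_cast
  field_simp
  ring

lemma hasDerivAt_besselSeries (n : ℕ) (z : ℝ) :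
    HasDerivAt (besselSeries n) (-besselSeries (n + 1) z) z := by
  have hsplit : besselSeries n = fun z => ((-1 : ℝ) ^ 0 / ((Nat.factorial 0 : ℝ) *
      (Nat.factorial (0 + n) : ℝ))) * z ^ 0 + ∑' k : ℕ, ((-1 : ℝ) ^ (k + 1) /
      ((Nat.factorial (k + 1) : ℝ) * (Nat.factorial (k + 1 + n) : ℝ))) * z ^ (k + 1) :=
    funext fun z => (summable_besselSeries n z).tsum_eq_zero_add
  have hsum (z : ℝ) := (summable_nat_add_iff 1).2 (summable_besselSeries n z)
  rw [hsplit, besselSeries, ← tsum_neg]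
  simp only [pow_zero]
  refine HasDerivAt.const_add _ ?_
  refine hasDerivAt_tsum_of_isPreconnected (t := Metric.ball 0 (|z| + 1)) (y₀ := z) (y := z)
    (g := fun k z => ((-1 : ℝ) ^ (k + 1) / ((Nat.factorial (k + 1) : ℝ) *
      (Nat.factorial (k + 1 + n) : ℝ))) * z ^ (k + 1))
    (g' := fun k z => -(((-1 : ℝ) ^ k / ((Nat.factorial k : ℝ) *
      (Nat.factorial (k + (n + 1)) : ℝ))) * z ^ k))
    (Real.summable_pow_div_factorial (|z| + 1)) Metric.isOpen_ball
    (convex_ball _ _).isPreconnected (fun k y _ => ?_) (fun k y hy => ?_) (by simp)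
    (hsum z) (by simp)
  · rw [← besselSeries_derivTerm]
    simpa using (hasDerivAt_pow (k + 1) y).const_mul ((-1 : ℝ) ^ (k + 1) /
      ((Nat.factorial (k + 1) : ℝ) * (Nat.factorial (k + 1 + n) : ℝ)))
  · rw [norm_neg]
    refine (abs_besselSeries_term_le _ k y).trans ?_
    have : |y| ≤ |z| + 1 := by simpa using (Metric.mem_ball.1 hy).le
    gcongr

@[fun_prop]
lemma continuous_besselSeries (n : ℕ) : Continuous (besselSeries n) :=
  continuous_iff_continuousAt.2 fun z => (hasDerivAt_besselSeries n z).continuousAt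

/-- The three-term recurrence, i.e. the Bessel differential equation for `besselSeries n`. -/
lemma besselSeries_recurrence (n : ℕ) (z : ℝ) :
    z * besselSeries (n + 2) z = (n + 1) * besselSeries (n + 1) z - besselSeries n z := by
  have e : ((n : ℝ) + 1) * besselSeries (n + 1) z - besselSeries n z =
      ∑' k : ℕ, (((n : ℝ) + 1) * (((-1 : ℝ) ^ k / ((Nat.factorial k : ℝ) *
        (Nat.factorial (k + (n + 1)) : ℝ))) * z ^ k) - ((-1 : ℝ) ^ k / ((Nat.factorial k : ℝ) *
        (Nat.factorial (k + n) : ℝ))) * z ^ k) := by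
    rw [((summable_besselSeries (n + 1) z).mul_left _).tsum_sub (summable_besselSeries n z),
      tsum_mul_left, besselSeries, besselSeries]
  rw [e, (((summable_besselSeries (n + 1) z).mul_left _).sub
    (summable_besselSeries n z)).tsum_eq_zero_add, besselSeries, ← tsum_mul_left]
  have h0 : ((n : ℝ) + 1) * (((-1 : ℝ) ^ 0 / ((Nat.factorial 0 : ℝ) *
        (Nat.factorial (0 + (n + 1)) : ℝ))) * z ^ 0) - ((-1 : ℝ) ^ 0 / ((Nat.factorial 0 : ℝ) *
        (Nat.factorial (0 + n) : ℝ))) * z ^ 0 = 0 := by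
    have h1 : (Nat.factorial n : ℝ) ≠ 0 := by exact_mod_cast Nat.factorial_ne_zero _
    simp only [zero_add, Nat.factorial_succ n]
    push_cast
    field_simp
    ring
  rw [h0, zero_add]
  refine tsum_congr fun k => ?_
  have h0 : (Nat.factorial k : ℝ) ≠ 0 := by exact_mod_cast Nat.factorial_ne_zero _
  have h1 : (Nat.factorial (k + n + 1) : ℝ) ≠ 0 := by exact_mod_cast Nat.factorial_ne_zero _
  rw [show k + 1 + (n + 1) = k + n + 1 + 1 by ring, show k + (n + 2) = k + n + 1 + 1 by ring,
    show k + 1 + n = k + n + 1 by ring, Nat.factorial_succ (k + n + 1), Nat.factorial_succ k]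
  push_cast
  have h2 : (k : ℝ) + n + 1 + 1 ≠ 0 := by positivity
  field_simp
  ring

lemma J1_eq_besselSeries (x : ℝ) : J1 x = x / 2 * besselSeries 1 (x ^ 2 / 4) := by
  rw [J1, besselSeries]
  congr 1
  refine tsum_congr fun k => ?_
  rw [pow_mul]
  congr 2
  ring

/-- An antiderivative encoding the integrated Bessel equation. -/
lemma hasDerivAt_mul_besselSeries_sqrt (b : ℝ) {w : ℝ} (hw : 0 < w) :
    HasDerivAt (fun w => w * (besselSeries 1 (b * √w) * besselSeries 2 (b * √w)))
      ((besselSeries 1 (b * √w) ^ 2 - b * √w * besselSeries 2 (b * √w) ^ 2) / 2) w := by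
  have hs := ((hasDerivAt_id w).sqrt hw.ne').const_mul b
  have h1 := (hasDerivAt_besselSeries 1 (b * √w)).comp w hs
  have h2 := (hasDerivAt_besselSeries 2 (b * √w)).comp w hs
  refine ((hasDerivAt_id w).mul (h1.mul h2)).congr_deriv ?_
  have h3 := besselSeries_recurrence 1 (b * √w)
  have hne : √w ≠ 0 := (Real.sqrt_pos.2 hw).ne'
  have hsq : √w ^ 2 = w := Real.sq_sqrt hw.le
  norm_num at h3 ⊢
  generalize besselSeries 1 (b * √w) = G1 at *
  generalize besselSeries 2 (b * √w) = G2 at *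
  generalize besselSeries 3 (b * √w) = G3 at *
  generalize √w = s at *
  subst hsq
  field_simp
  linear_combination (-G1) * h3

lemma integral_besselSeries_sqrt_eq (b : ℝ) {a : ℝ} (ha : 0 ≤ a)
    (h : besselSeries 1 (b * √a) = 0) :
    ∫ w in 0..a, b * √w * besselSeries 2 (b * √w) ^ 2 =
      ∫ w in 0..a, besselSeries 1 (b * √w) ^ 2 := by
  have key := intervalIntegral.integral_eq_sub_of_hasDerivAt_of_le ha
    (f := fun w => w * (besselSeries 1 (b * √w) * besselSeries 2 (b * √w)))
    (by fun_prop) (fun w hw => hasDerivAt_mul_besselSeries_sqrt b hw.1)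
    (Continuous.intervalIntegrable (by fun_prop) _ _)
  rw [intervalIntegral.integral_div, intervalIntegral.integral_sub
    (Continuous.intervalIntegrable (by fun_prop) _ _)
    (Continuous.intervalIntegrable (by fun_prop) _ _)] at key
  simp only [h, zero_mul, mul_zero, sub_zero] at key
  linarith

/-- The fourth power of the Koranyi norm. -/
def ρH4 (η : H1) : ℝ := (η.1 ^ 2 + η.2.1 ^ 2) ^ 2 + η.2.2 ^ 2

@[fun_prop]
lemma continuous_ρH4 : Continuous ρH4 := by unfold ρH4; fun_prop

lemma ρH4_nonneg (η : H1) : 0 ≤ ρH4 η := by unfold ρH4; positivity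

/-- The density `ψ = |∇_ℍ ρ|²`. -/
def ψH (η : H1) : ℝ := (η.1 ^ 2 + η.2.1 ^ 2) / √(ρH4 η)

lemma ψH_nonneg (η : H1) : 0 ≤ ψH η := by unfold ψH; positivity

lemma ψH_le_one (η : H1) : ψH η ≤ 1 := by
  refine div_le_one_of_le₀ (Real.le_sqrt_of_sq_le ?_) (Real.sqrt_nonneg _)
  unfold ρH4
  nlinarith [sq_nonneg η.2.2]

lemma measurable_ψH : Measurable ψH := by
  unfold ψH
  fun_prop

/-- The measure with density `ψ`. -/
def ψMeasure : Measure H1 := volume.withDensity fun η => ENNReal.ofReal (ψH η)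

/-- The anisotropic dilation of the Heisenberg group. -/
def dilationH (r : ℝ) : H1 →ₗ[ℝ] H1 :=
  (r • LinearMap.id).prodMap ((r • LinearMap.id).prodMap (r ^ 2 • LinearMap.id))

instance : (volume : Measure H1).IsAddHaarMeasure :=
  have : (volume : Measure (ℝ × ℝ)).IsAddHaarMeasure :=
    Measure.prod.instIsAddHaarMeasure volume volume
  Measure.prod.instIsAddHaarMeasure volume volume

lemma det_dilationH (r : ℝ) : LinearMap.det (dilationH r) = r ^ 4 := by
  simp only [dilationH, LinearMap.det_prodMap, LinearMap.det_smul, LinearMap.det_id,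
    Module.finrank_self]
  ring

lemma ρH4_dilationH (r : ℝ) (η : H1) : ρH4 (dilationH r η) = r ^ 4 * ρH4 η := by
  simp only [dilationH, ρH4, LinearMap.prodMap_apply, LinearMap.smul_apply, LinearMap.id_apply,
    smul_eq_mul]
  ring

lemma ψH_dilationH {r : ℝ} (hr : 0 < r) (η : H1) : ψH (dilationH r η) = ψH η := by
  rw [ψH, ρH4_dilationH, show r ^ 4 = (r ^ 2) ^ 2 by ring, Real.sqrt_mul (by positivity),
    Real.sqrt_sq (by positivity), ψH]
  simp only [dilationH, LinearMap.prodMap_apply, LinearMap.smul_apply, LinearMap.id_apply,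
    smul_eq_mul]
  rw [show (r * η.1) ^ 2 + (r * η.2.1) ^ 2 = r ^ 2 * (η.1 ^ 2 + η.2.1 ^ 2) by ring,
    mul_div_mul_left _ _ (by positivity)]

lemma measurableSet_ρH4_lt (a : ℝ) : MeasurableSet {η | ρH4 η < a} :=
  (isOpen_lt continuous_ρH4 continuous_const).measurableSet

lemma ψMeasure_ball_lt_top : ψMeasure {η | ρH4 η < 1} < ⊤ := by
  calc ψMeasure {η | ρH4 η < 1} = ∫⁻ η in {η | ρH4 η < 1}, ENNReal.ofReal (ψH η) :=
        withDensity_apply _ (measurableSet_ρH4_lt 1)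
    _ ≤ ∫⁻ η in {η | ρH4 η < 1}, 1 :=
        lintegral_mono fun η => by simpa using ENNReal.ofReal_le_ofReal (ψH_le_one η)
    _ = volume {η | ρH4 η < 1} := setLIntegral_one _
    _ ≤ volume (Metric.closedBall (0 : H1) 1) := by
        refine measure_mono fun η hη => ?_
        have h : (η.1 ^ 2 + η.2.1 ^ 2) ^ 2 + η.2.2 ^ 2 < 1 := hη
        have h1 : η.1 ^ 2 + η.2.1 ^ 2 ≤ 1 := by nlinarith [sq_nonneg η.2.2]
        simp only [Metric.mem_closedBall, dist_zero_right, Prod.norm_def, sup_le_iff,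
          Real.norm_eq_abs, abs_le_one_iff_mul_self_le_one]
        refine ⟨?_, ?_, ?_⟩ <;> nlinarith [sq_nonneg η.1, sq_nonneg η.2.1]
    _ < ⊤ := (isCompact_closedBall _ _).measure_lt_top

lemma ψMeasure_ball (a : ℝ) :
    ψMeasure {η | ρH4 η < a} = ψMeasure {η | ρH4 η < 1} * ENNReal.ofReal a := by
  rcases le_or_gt a 0 with ha | ha
  · have : {η | ρH4 η < a} = ∅ := by
      ext η
      simpa using ha.trans (ρH4_nonneg η)
    simp [this, ENNReal.ofReal_of_nonpos ha]
  obtain ⟨r, hr, rfl⟩ : ∃ r : ℝ, 0 < r ∧ r ^ 4 = a :=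
    ⟨a ^ ((1 : ℝ) / 4), by positivity, by
      rw [← Real.rpow_natCast, ← Real.rpow_mul ha.le]; norm_num⟩
  have hd : LinearMap.det (dilationH r) ≠ 0 := by rw [det_dilationH]; positivity
  have hcont : Continuous (dilationH r) := LinearMap.continuous_of_finiteDimensional _
  have hmap := Measure.map_linearMap_addHaar_eq_smul_addHaar (volume : Measure H1) hd
  have hpre : dilationH r ⁻¹' {η | ρH4 η < r ^ 4} = {η | ρH4 η < 1} := by
    ext η
    simp only [mem_preimage, mem_ofPred_eq, ρH4_dilationH]
    exact mul_lt_iff_lt_one_right (by positivity)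
  have h1 : ∫⁻ η in {η | ρH4 η < r ^ 4}, ENNReal.ofReal (ψH η)
      ∂(Measure.map (dilationH r) volume) = ∫⁻ η in {η | ρH4 η < 1}, ENNReal.ofReal (ψH η) := by
    rw [setLIntegral_map (measurableSet_ρH4_lt _) measurable_ψH.ennreal_ofReal hcont.measurable,
      hpre]
    simp only [ψH_dilationH hr]
  rw [hmap, Measure.restrict_smul, lintegral_smul_measure, det_dilationH,
    abs_of_pos (by positivity), smul_eq_mul] at h1
  rw [ψMeasure, withDensity_apply _ (measurableSet_ρH4_lt _),
    withDensity_apply _ (measurableSet_ρH4_lt _), ← h1, mul_right_comm,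
    ← ENNReal.ofReal_mul (by positivity), inv_mul_cancel₀ (by positivity), ENNReal.ofReal_one,
    one_mul]

lemma map_ρH4_ψMeasure (a : ℝ) :
    (ψMeasure.restrict {η | ρH4 η < a}).map ρH4 =
      ψMeasure {η | ρH4 η < 1} • volume.restrict (Ioo 0 a) := by
  have hC := ψMeasure_ball_lt_top
  have : IsFiniteMeasure ((ψMeasure.restrict {η | ρH4 η < a}).map ρH4) := by
    constructor
    rw [Measure.map_apply continuous_ρH4.measurable MeasurableSet.univ, preimage_univ,
      Measure.restrict_apply_univ, ψMeasure_ball]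
    exact ENNReal.mul_lt_top hC ENNReal.ofReal_lt_top
  refine ext_of_generate_finite _ (borel_eq_generateFrom_Iio ℝ ▸ BorelSpace.measurable_eq)
    isPiSystem_Iio ?_ ?_
  · rintro _ ⟨b, rfl⟩
    rw [Measure.map_apply continuous_ρH4.measurable measurableSet_Iio, Measure.restrict_apply
      (continuous_ρH4.measurable measurableSet_Iio), Measure.smul_apply,
      Measure.restrict_apply measurableSet_Iio, inter_comm (Iio b), Ioo_inter_Iio,
      Real.volume_Ioo, sub_zero, smul_eq_mul, ← ψMeasure_ball]
    congr 1
    ext η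
    simp [and_comm]
  · rw [Measure.map_apply continuous_ρH4.measurable MeasurableSet.univ, preimage_univ,
      Measure.restrict_apply_univ, Measure.smul_apply, Measure.restrict_apply_univ,
      Real.volume_Ioo, sub_zero, smul_eq_mul, ← ψMeasure_ball]

/-- Integration in polar coordinates for functions of the form `ψ · g(ρ⁴)`. -/
lemma setIntegral_ψH_mul {g : ℝ → ℝ} (hg : Continuous g) {a : ℝ} (ha : 0 ≤ a) :
    ∫ η in {η | ρH4 η < a}, ψH η * g (ρH4 η) =
      (ψMeasure {η | ρH4 η < 1}).toReal * ∫ w in 0..a, g w := by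
  have h1 := setIntegral_withDensity_eq_setIntegral_toReal_smul' (μ := volume)
    {η | ρH4 η < a} measurable_ψH.ennreal_ofReal (ae_of_all _ fun _ => ENNReal.ofReal_lt_top)
    (fun η => g (ρH4 η))
  simp only [ENNReal.toReal_ofReal (ψH_nonneg _), smul_eq_mul] at h1
  rw [← h1, intervalIntegral.integral_of_le ha, integral_Ioc_eq_integral_Ioo, ← smul_eq_mul,
    ← integral_smul_measure, ← map_ρH4_ψMeasure,
    integral_map continuous_ρH4.aemeasurable hg.aestronglyMeasurable]
  rfl

lemma ρH_sq (η : H1) : ρH η ^ 2 = √(ρH4 η) := by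
  rw [Real.sqrt_eq_rpow, ρH, ← ρH4, ← Real.rpow_natCast, ← Real.rpow_mul (ρH4_nonneg η)]
  norm_num

lemma ρH_nonneg (η : H1) : 0 ≤ ρH η := Real.rpow_nonneg (ρH4_nonneg η) _

lemma ρH_pow_four (η : H1) : ρH η ^ 4 = ρH4 η := by
  rw [show ρH η ^ 4 = (ρH η ^ 2) ^ 2 by ring, ρH_sq, Real.sq_sqrt (ρH4_nonneg η)]

lemma hasFDerivAt_ρH4 (η : H1) : HasFDerivAt ρH4
    ((4 * η.1 * (η.1 ^ 2 + η.2.1 ^ 2)) • ContinuousLinearMap.fst ℝ ℝ (ℝ × ℝ) +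
      (4 * η.2.1 * (η.1 ^ 2 + η.2.1 ^ 2)) •
        (ContinuousLinearMap.fst ℝ ℝ ℝ).comp (ContinuousLinearMap.snd ℝ ℝ (ℝ × ℝ)) +
      (2 * η.2.2) •
        (ContinuousLinearMap.snd ℝ ℝ ℝ).comp (ContinuousLinearMap.snd ℝ ℝ (ℝ × ℝ))) η := by
  have hx : HasFDerivAt (fun η : H1 => η.1) (ContinuousLinearMap.fst ℝ ℝ (ℝ × ℝ)) η := hasFDerivAt_fst
  have h2 : HasFDerivAt (fun η : H1 => η.2) (ContinuousLinearMap.snd ℝ ℝ (ℝ × ℝ)) η := hasFDerivAt_snd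
  have hy := h2.fst
  have ht := h2.snd
  refine ((((hx.pow 2).add (hy.pow 2)).pow 2).add (ht.pow 2)).congr_fderiv ?_
  ext <;> simp <;> ring

/-- The squared horizontal gradient of a function of `ρ⁴`. -/
lemma Xd_sq_add_Yd_sq {u : H1 → ℝ} {φ : ℝ → ℝ} {φ' : ℝ} {η : H1}
    (hu : u =ᶠ[nhds η] fun ξ => φ (ρH4 ξ)) (hφ : HasDerivAt φ φ' (ρH4 η)) :
    Xd u η ^ 2 + Yd u η ^ 2 = 16 * (η.1 ^ 2 + η.2.1 ^ 2) * ρH4 η * φ' ^ 2 := by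
  have h := hu.fderiv_eq.trans (hφ.comp_hasFDerivAt η (hasFDerivAt_ρH4 η)).fderiv
  rw [Xd, Yd, h]
  simp [ρH4]
  ring

lemma radial_J1_eq {c : ℝ} {η : H1} (h : 0 < ρH4 η) :
    (1 / ρH η) * J1 (c * ρH η) = c / 2 * besselSeries 1 (c ^ 2 / 4 * √(ρH4 η)) := by
  have hρ : ρH η ≠ 0 := by
    intro h0
    rw [← ρH_pow_four, h0] at h
    norm_num at h
  rw [J1_eq_besselSeries, ← ρH_sq, show (c * ρH η) ^ 2 / 4 = c ^ 2 / 4 * ρH η ^ 2 by ring]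
  field_simp

lemma radial_J1_gradient {c : ℝ} {η : H1} (h : 0 < ρH4 η) :
    Xd (fun η => (1 / ρH η) * J1 (c * ρH η)) η ^ 2 +
        Yd (fun η => (1 / ρH η) * J1 (c * ρH η)) η ^ 2 =
      c ^ 2 * (ψH η * ((c / 2) ^ 2 *
        (c ^ 2 / 4 * √(ρH4 η) * besselSeries 2 (c ^ 2 / 4 * √(ρH4 η)) ^ 2))) := by
  have hu : (fun η => (1 / ρH η) * J1 (c * ρH η)) =ᶠ[nhds η]
      fun ξ => (fun w => c / 2 * besselSeries 1 (c ^ 2 / 4 * √w)) (ρH4 ξ) := by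
    filter_upwards [(isOpen_lt continuous_const continuous_ρH4).mem_nhds h] with ξ hξ
    exact radial_J1_eq hξ
  have hs := ((hasDerivAt_id (ρH4 η)).sqrt h.ne').const_mul (c ^ 2 / 4)
  have hφ := ((hasDerivAt_besselSeries 1 (c ^ 2 / 4 * √(ρH4 η))).comp (ρH4 η) hs).const_mul (c / 2)
  rw [Xd_sq_add_Yd_sq hu hφ, ψH]
  have hne : √(ρH4 η) ≠ 0 := (Real.sqrt_pos.2 h).ne'
  have hsq : √(ρH4 η) ^ 2 = ρH4 η := Real.sq_sqrt h.le
  norm_num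
  generalize besselSeries 2 (c ^ 2 / 4 * √(ρH4 η)) = G2 at *
  generalize √(ρH4 η) = s at *
  rw [← hsq]
  field_simp
  ring

lemma ae_ρH4_pos : ∀ᵐ η : H1, 0 < ρH4 η := by
  filter_upwards [compl_mem_ae_iff.2 (measure_singleton (0 : H1))] with η hη
  refine (ρH4_nonneg η).lt_of_ne fun h => hη ?_
  have h' : (η.1 ^ 2 + η.2.1 ^ 2) ^ 2 + η.2.2 ^ 2 = 0 := h.symm
  have ht : η.2.2 = 0 := by nlinarith [sq_nonneg (η.1 ^ 2 + η.2.1 ^ 2), sq_nonneg η.2.2]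
  have hs : η.1 ^ 2 + η.2.1 ^ 2 = 0 := by
    nlinarith [sq_nonneg (η.1 ^ 2 + η.2.1 ^ 2), sq_nonneg η.2.2]
  have hx : η.1 = 0 := by nlinarith [sq_nonneg η.1, sq_nonneg η.2.1]
  have hy : η.2.1 = 0 := by nlinarith [sq_nonneg η.1, sq_nonneg η.2.1]
  exact Prod.ext hx (Prod.ext hy ht)

/-- For the radial eigenfunction u(η) = (1/ρ(η))·J₁(l·ρ(η)/R) with
J₁(l) = 0, ∫_{B(0,R)} |∇_ℍ u|² = (l²/R²)·∫_{B(0,R)} ψ·u², ψ = (x²+y²)/ρ². -/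
theorem bessel_dirichlet_identity (R l : ℝ) (hR : 0 < R) (hl : 0 < l)
    (hzero : J1 l = 0) :
    let u : H1 → ℝ := fun η => (1 / ρH η) * J1 (l * ρH η / R)
    ∫ η in {η : H1 | ρH η < R}, ((Xd u η) ^ 2 + (Yd u η) ^ 2) =
      l ^ 2 / R ^ 2 *
        ∫ η in {η : H1 | ρH η < R}, ((η.1 ^ 2 + η.2.1 ^ 2) / ρH η ^ 2) * (u η) ^ 2 := by
  intro u
  obtain ⟨c, hc⟩ : ∃ c, c = l / R := ⟨_, rfl⟩
  have hu : u = fun η => (1 / ρH η) * J1 (c * ρH η) := by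
    funext η
    simp only [u, hc, div_mul_eq_mul_div]
  have hball : {η : H1 | ρH η < R} = {η | ρH4 η < R ^ 4} := by
    ext η
    rw [mem_ofPred_eq, mem_ofPred_eq, ← ρH_pow_four,
      pow_lt_pow_iff_left₀ (ρH_nonneg η) hR.le (by norm_num)]
  have hG : besselSeries 1 (c ^ 2 / 4 * √(R ^ 4)) = 0 := by
    have hJ := J1_eq_besselSeries l
    rw [hzero, eq_comm, mul_eq_zero, or_iff_right (by positivity)] at hJ
    rw [show R ^ 4 = (R ^ 2) ^ 2 by ring, Real.sqrt_sq (by positivity), ← hJ, hc]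
    congr 1
    field_simp
  rw [← div_pow, ← hc, hball, hu,
    integral_congr_ae (g := fun η => c ^ 2 * (ψH η * ((c / 2) ^ 2 *
        (c ^ 2 / 4 * √(ρH4 η) * besselSeries 2 (c ^ 2 / 4 * √(ρH4 η)) ^ 2))))
      (ae_restrict_of_ae (ae_ρH4_pos.mono fun η h => radial_J1_gradient h)),
    integral_congr_ae (f := fun η : H1 => (η.1 ^ 2 + η.2.1 ^ 2) / ρH η ^ 2 * _)
      (g := fun η => ψH η * ((c / 2) ^ 2 * besselSeries 1 (c ^ 2 / 4 * √(ρH4 η)) ^ 2))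
      (ae_restrict_of_ae (ae_ρH4_pos.mono fun η h => by
        simp only [radial_J1_eq h, ρH_sq, ψH, mul_pow])),
    integral_const_mul,
    setIntegral_ψH_mul (g := fun w => (c / 2) ^ 2 *
      (c ^ 2 / 4 * √w * besselSeries 2 (c ^ 2 / 4 * √w) ^ 2)) (by fun_prop) (by positivity),
    setIntegral_ψH_mul (g := fun w => (c / 2) ^ 2 * besselSeries 1 (c ^ 2 / 4 * √w) ^ 2)
      (by fun_prop) (by positivity),
    intervalIntegral.integral_const_mul, intervalIntegral.integral_const_mul,
    integral_besselSeries_sqrt_eq _ (by positivity) hG]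
end
end

section
/- Let Ω ⊆ ℝ³ be a bounded open set with smooth boundary such that Ω and ℍ¹ ∖ closure(Ω) satisfy the uniform exterior ball property, let ξ ∈ Ω, and let H be a regular part of the Green's function of Ω at ξ with H(ξ) > 0 and harmonic radius r_Ω(ξ) = 1/√(8π H(ξ)). Then the first Dirichlet eigenvalue of the Kohn-Laplacian satisfies λ₁(Ω) ≤ C_Ω(ξ) · l₁₁² / r_Ω(ξ)², where C_Ω(ξ) = 16√2 · α_Ω(ξ)⁶ · √(3/(2π)), α_Ω(ξ) = (sup_{η∈∂Ω} d(ξ,η))/(inf_{η∈∂Ω} d(ξ,η)), and l₁₁ is the smallest strictly positive zero of the Bessel function J₁. -/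
open MeasureTheory Real Set

noncomputable section

/-- A function with a local minimum at a point where it is differentiable nearby has nonnegative
second derivative there. -/
lemma IsLocalMin.deriv_deriv_nonneg {f : ℝ → ℝ} {a : ℝ} (hmin : IsLocalMin f a)
    (hc : ContinuousAt f a) : 0 ≤ deriv (deriv f) a := by
  by_contra! hneg
  have hmax := isLocalMax_of_deriv_deriv_neg hneg hmin.deriv_eq_zero hc
  have hconst : f =ᶠ[nhds a] fun _ => f a := by
    filter_upwards [hmin, hmax] with s h1 h2 using le_antisymm h2 h1
  have h1 : deriv f =ᶠ[nhds a] deriv fun _ => f a := hconst.deriv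
  rw [h1.deriv_eq] at hneg
  simp at hneg

/-- Second order necessary condition along a field `V` which is constant on its own integral
lines, for the perturbation of `H` by a multiple of the square of the first coordinate. -/
lemma second_order_along_field {H : H1 → ℝ} {η : H1} (hH : ContDiffAt ℝ 2 H η) {V : H1 → H1}
    (hV : DifferentiableAt ℝ V η) (hline : ∀ s : ℝ, V (η + s • V η) = V η) (ε : ℝ)
    (hmin : IsLocalMin (fun p : H1 => H p - ε * p.1 ^ 2) η) :
    2 * ε * (V η).1 ^ 2 ≤ fderiv ℝ (fun p => fderiv ℝ H p (V p)) η (V η) := by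
  set v := V η with hv
  have hγ : ∀ s : ℝ, HasDerivAt (fun s : ℝ => η + s • v) v s := fun s => by
    simpa using ((hasDerivAt_id s).smul_const v).const_add η
  have hγ0 : Filter.Tendsto (fun s : ℝ => η + s • v) (nhds 0) (nhds η) := by
    have := (hγ 0).continuousAt.tendsto
    simpa using this
  set φ : ℝ → ℝ := fun s => H (η + s • v) - ε * (η.1 + s * v.1) ^ 2 with hφ
  have hφmin : IsLocalMin φ 0 := by
    have := hγ0.eventually hmin
    filter_upwards [this] with s hs
    simpa [hφ] using hs
  have hdiff : ∀ᶠ p in nhds η, DifferentiableAt ℝ H p := by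
    filter_upwards [hH.eventually (by simp)] with p hp using hp.differentiableAt (by simp)
  have hd1 : ∀ s : ℝ, DifferentiableAt ℝ H (η + s • v) →
      HasDerivAt φ (fderiv ℝ H (η + s • v) v - ε * (2 * (η.1 + s * v.1) * v.1)) s := by
    intro s hs
    have h1 : HasDerivAt (fun s : ℝ => H (η + s • v)) (fderiv ℝ H (η + s • v) v) s :=
      hs.hasFDerivAt.comp_hasDerivAt s (hγ s)
    have h2 : HasDerivAt (fun s : ℝ => ε * (η.1 + s * v.1) ^ 2)
        (ε * (2 * (η.1 + s * v.1) * v.1)) s := by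
      have := ((((hasDerivAt_id s).mul_const v.1).const_add η.1).pow 2).const_mul ε
      simpa using this
    exact h1.sub h2
  have hd2 : deriv φ =ᶠ[nhds 0] fun s => (fun p => fderiv ℝ H p (V p)) (η + s • v)
      - ε * (2 * (η.1 + s * v.1) * v.1) := by
    filter_upwards [hγ0.eventually hdiff] with s hs
    rw [(hd1 s hs).deriv, hline s]
  have hD : DifferentiableAt ℝ (fun p => fderiv ℝ H p (V p)) η :=
    ((hH.fderiv_right (m := 1) (by norm_num)).differentiableAt (by simp)).clm_apply hV
  have hd3 : HasDerivAt (fun s => (fun p => fderiv ℝ H p (V p)) (η + s • v)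
      - ε * (2 * (η.1 + s * v.1) * v.1))
      (fderiv ℝ (fun p => fderiv ℝ H p (V p)) η v - ε * (2 * v.1 * v.1)) 0 := by
    have hD' : HasFDerivAt (fun p => fderiv ℝ H p (V p))
        (fderiv ℝ (fun p => fderiv ℝ H p (V p)) η) (η + (0 : ℝ) • v) := by
      simpa using hD.hasFDerivAt
    have h1 := hD'.comp_hasDerivAt 0 (hγ 0)
    have h2 : HasDerivAt (fun s : ℝ => ε * (2 * (η.1 + s * v.1) * v.1)) (ε * (2 * v.1 * v.1)) 0 := by
      have := (((((hasDerivAt_id (0 : ℝ)).mul_const v.1).const_add η.1).const_mul 2).mul_const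
        v.1).const_mul ε
      simpa using this
    exact h1.sub h2
  have hc : ContinuousAt φ 0 :=
    (hd1 0 (by simpa using hH.differentiableAt (by simp))).continuousAt
  have := hφmin.deriv_deriv_nonneg hc
  rw [hd2.deriv_eq, hd3.deriv] at this
  linarith

/-- Weak minimum principle for the Kohn-Laplacian. -/
lemma kohn_min_principle {Ω : Set H1} (hΩo : IsOpen Ω) (hΩb : Bornology.IsBounded Ω) {H : H1 → ℝ}
    (hHc : ContinuousOn H (closure Ω)) (hHd : ContDiffOn ℝ 2 H Ω)
    (hHh : ∀ η ∈ Ω, kohn H η = 0) {m : ℝ} (hm : ∀ η ∈ frontier Ω, m ≤ H η)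
    {ξ : H1} (hξ : ξ ∈ Ω) : m ≤ H ξ := by
  have hcpt : IsCompact (closure Ω) := hΩb.isCompact_closure
  obtain ⟨K, hK⟩ : ∃ K : ℝ, ∀ p ∈ closure Ω, p.1 ^ 2 ≤ K := by
    obtain ⟨K, hK⟩ := hcpt.bddAbove_image (f := fun p : H1 => p.1 ^ 2) (by fun_prop)
    exact ⟨K, fun p hp => hK (mem_image_of_mem _ hp)⟩
  have hK0 : 0 ≤ K := (sq_nonneg ξ.1).trans (hK ξ (subset_closure hξ))
  refine le_of_forall_pos_le_add fun δ hδ => ?_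
  set ε := δ / (K + 1) with hε
  have hεpos : 0 < ε := by positivity
  have hεK : ε * K ≤ δ := by
    rw [hε, div_mul_eq_mul_div, div_le_iff₀ (by positivity)]
    nlinarith
  obtain ⟨p, hp, hpmin⟩ := hcpt.exists_isMinOn ⟨ξ, subset_closure hξ⟩
    (f := fun p : H1 => H p - ε * p.1 ^ 2) (hHc.sub (by fun_prop))
  have hpΩ : p ∉ Ω := by
    intro hpΩ
    have hnh : Ω ∈ nhds p := hΩo.mem_nhds hpΩ
    have hloc : IsLocalMin (fun p : H1 => H p - ε * p.1 ^ 2) p := by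
      filter_upwards [hnh] with q hq using hpmin (subset_closure hq)
    have hX := second_order_along_field (hHd.contDiffAt hnh)
      (V := fun q : H1 => ((1 : ℝ), (0 : ℝ), 2 * q.2.1)) (by fun_prop) (by intro s; simp) ε hloc
    have hY := second_order_along_field (hHd.contDiffAt hnh)
      (V := fun q : H1 => ((0 : ℝ), (1 : ℝ), -2 * q.1)) (by fun_prop) (by intro s; simp) ε hloc
    have h0 := hHh p hpΩ
    simp only [kohn] at h0
    change _ ≤ Xd (Xd H) p at hX
    change _ ≤ Yd (Yd H) p at hY
    norm_num at hX hY
    linarith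
  have hpf : p ∈ frontier Ω := ⟨hp, by rwa [hΩo.interior_eq]⟩
  have h1 := hpmin (subset_closure hξ)
  have h1 : H p - ε * p.1 ^ 2 ≤ H ξ - ε * ξ.1 ^ 2 := h1
  have h2 := hm p hpf
  have h3 := mul_le_mul_of_nonneg_left (hK p hp) hεpos.le
  have h4 : 0 ≤ ε * ξ.1 ^ 2 := by positivity
  linarith

/-- The series defining `J₁` is positive as long as `l² < 6`. -/
lemma J1_pos {l : ℝ} (hl : 0 < l) (hl2 : l ^ 2 < 6) : 0 < J1 l := by
  set x : ℝ := (l / 2) ^ 2 with hx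
  have hx0 : 0 < x := by positivity
  have hx1 : x < 3 / 2 := by rw [hx]; linarith
  set a : ℕ → ℝ := fun k => (-1 : ℝ) ^ k / ((Nat.factorial k : ℝ) * (Nat.factorial (k + 1) : ℝ))
    * (l / 2) ^ (2 * k) with ha
  have hfact : ∀ k : ℕ, (2 : ℝ) * 6 ^ k ≤ (k + 1).factorial * (k + 1 + 1).factorial := by
    intro k
    induction k with
    | zero => norm_num [Nat.factorial]
    | succ k ih =>
      rw [Nat.factorial_succ (k + 1), Nat.factorial_succ (k + 1 + 1), pow_succ]
      push_cast at ih ⊢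
      have hk : (6 : ℝ) ≤ (k + 1 + 1) * (k + 1 + 1 + 1) := by
        have : (0 : ℝ) ≤ k := k.cast_nonneg
        nlinarith
      calc (2 : ℝ) * (6 ^ k * 6) = (2 * 6 ^ k) * 6 := by ring
        _ ≤ _ := mul_le_mul ih hk (by norm_num) (by positivity)
        _ = _ := by ring
  have hbound : ∀ k : ℕ, ‖a (k + 1)‖ ≤ x / 2 * (x / 6) ^ k := by
    intro k
    have : ‖a (k + 1)‖ = x ^ (k + 1) / ((k + 1).factorial * (k + 1 + 1).factorial) := by
      simp only [ha, norm_mul, norm_div, norm_pow, norm_neg, norm_one, one_pow, RCLike.norm_natCast,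
        Real.norm_eq_abs, pow_mul, ← hx]
      rw [abs_of_pos hx0]
      ring
    rw [this, div_le_iff₀ (by positivity)]
    calc x ^ (k + 1) = x / 2 * (x / 6) ^ k * (2 * 6 ^ k) := by
          rw [div_pow]; field_simp; ring
      _ ≤ _ := mul_le_mul_of_nonneg_left (hfact k) (by positivity)
  have hg : HasSum (fun k : ℕ => x / 2 * (x / 6) ^ k) (x / 2 * (1 - x / 6)⁻¹) :=
    (hasSum_geometric_of_lt_one (by positivity) (by linarith)).mul_left _
  have hs : Summable fun k => a (k + 1) := Summable.of_norm_bounded hg.summable hbound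
  have htail : ‖∑' k, a (k + 1)‖ ≤ x / 2 * (1 - x / 6)⁻¹ := tsum_of_norm_bounded hg hbound
  have hlt : x / 2 * (1 - x / 6)⁻¹ < 1 := by
    rw [← div_eq_mul_inv, div_lt_one (by linarith)]
    linarith
  have hsum : ∑' k, a k = 1 + ∑' k, a (k + 1) := by
    rw [((summable_nat_add_iff 1).1 hs).tsum_eq_zero_add]
    simp [ha]
  have : 0 < ∑' k, a k := by
    rw [hsum]
    have := (abs_le.1 htail).1
    linarith
  exact mul_pos (by positivity) this

/-- The fourth power of the Koranyi norm. -/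
def koranyiQuartic (p : H1) : ℝ := (p.1 ^ 2 + p.2.1 ^ 2) ^ 2 + p.2.2 ^ 2

lemma koranyiQuartic_nonneg (p : H1) : 0 ≤ koranyiQuartic p := by
  unfold koranyiQuartic; positivity

lemma koranyiQuartic_eq_zero {p : H1} (h : koranyiQuartic p = 0) : p = 0 := by
  have h3 : p.2.2 = 0 := by unfold koranyiQuartic at h; nlinarith [sq_nonneg (p.1 ^ 2 + p.2.1 ^ 2)]
  have h12 : p.1 ^ 2 + p.2.1 ^ 2 = 0 := by
    unfold koranyiQuartic at h; nlinarith [sq_nonneg (p.1 ^ 2 + p.2.1 ^ 2)]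
  have h1 : p.1 = 0 := by nlinarith [sq_nonneg p.2.1]
  have h2 : p.2.1 = 0 := by nlinarith [sq_nonneg p.1]
  exact Prod.ext h1 (Prod.ext h2 h3)

lemma koranyiQuartic_smul_le {s : ℝ} (h0 : 0 ≤ s) (h1 : s ≤ 1) (p : H1) :
    koranyiQuartic (s • p) ≤ koranyiQuartic p := by
  have hs : s ^ 2 ≤ 1 := pow_le_one₀ h0 h1
  have hs4 : s ^ 4 ≤ 1 := pow_le_one₀ h0 h1
  have : koranyiQuartic (s • p) = s ^ 4 * (p.1 ^ 2 + p.2.1 ^ 2) ^ 2 + s ^ 2 * p.2.2 ^ 2 := by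
    simp [koranyiQuartic]; ring
  rw [this, koranyiQuartic]
  nlinarith [sq_nonneg (p.1 ^ 2 + p.2.1 ^ 2), sq_nonneg p.2.2]

lemma contDiff_koranyiQuartic {n : WithTop ℕ∞} : ContDiff ℝ n koranyiQuartic := by
  unfold koranyiQuartic; fun_prop

lemma contDiff_hmul_left {n : WithTop ℕ∞} (ζ : H1) : ContDiff ℝ n (hmul ζ) := by
  unfold hmul; fun_prop

lemma kd_nonneg (ξ η : H1) : 0 ≤ kd ξ η := by
  unfold kd ρH; positivity

lemma kd_pow_four (ξ η : H1) : kd ξ η ^ 4 = koranyiQuartic (hmul (hinv ξ) η) := by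
  have h := koranyiQuartic_nonneg (hmul (hinv ξ) η)
  unfold koranyiQuartic at *
  rw [kd, ρH, ← Real.rpow_natCast, ← Real.rpow_mul h]
  norm_num

lemma continuous_kd (ξ : H1) : Continuous (kd ξ) := by
  have h : Continuous koranyiQuartic := (contDiff_koranyiQuartic (n := 0)).continuous
  have h' : Continuous (hmul (hinv ξ)) := (contDiff_hmul_left (n := 0) _).continuous
  exact (h.rpow_const (fun _ => Or.inr (by norm_num))).comp h'

lemma kd_pos {ξ η : H1} (h : η ≠ ξ) : 0 < kd ξ η := by
  refine (kd_nonneg ξ η).lt_of_ne' fun h0 => h ?_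
  have h4 := kd_pow_four ξ η
  rw [h0] at h4
  have hp := koranyiQuartic_eq_zero (p := hmul (hinv ξ) η) (by rw [← h4]; norm_num)
  simp only [hmul, hinv, Prod.ext_iff, Prod.fst_zero, Prod.snd_zero] at hp
  obtain ⟨h1, h2, h3⟩ := hp
  have h1 : η.1 = ξ.1 := by linarith
  have h2 : η.2.1 = ξ.2.1 := by linarith
  rw [h1, h2] at h3
  exact Prod.ext h1 (Prod.ext h2 (by linarith))

lemma hmul_hinv_segment (ξ η : H1) (s : ℝ) :
    hmul (hinv ξ) (ξ + s • (η - ξ)) = s • hmul (hinv ξ) η := by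
  simp only [hmul, hinv, Prod.fst_add, Prod.snd_add, Prod.smul_fst, Prod.smul_snd, Prod.fst_sub,
    Prod.snd_sub, smul_eq_mul, Prod.ext_iff]
  refine ⟨by ring, by ring, by ring⟩

/-- An open set contains every Koranyi ball about one of its points which does not meet its
frontier. -/
lemma mem_of_kd_lt {Ω : Set H1} (hΩo : IsOpen Ω) {ξ : H1} (hξ : ξ ∈ Ω) {R : ℝ}
    (hR : ∀ η ∈ frontier Ω, R ≤ kd ξ η) {η : H1} (hη : kd ξ η < R) : η ∈ Ω := by
  set γ : ℝ → H1 := fun s => ξ + s • (η - ξ) with hγ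
  have hc : Continuous γ := by fun_prop
  have hpre : IsPreconnected (γ '' Icc 0 1) := isPreconnected_Icc.image _ hc.continuousOn
  have hsub : γ '' Icc 0 1 ⊆ Ω := by
    refine hpre.subset_of_closure_inter_subset hΩo
      ⟨ξ, ⟨0, by simp, by simp [hγ]⟩, hξ⟩ ?_
    rintro _ ⟨hcl, s, hs, rfl⟩
    by_contra hn
    have h1 := hR _ ⟨hcl, by rwa [hΩo.interior_eq]⟩
    have h2 : kd ξ (γ s) ≤ kd ξ η := by
      refine le_of_pow_le_pow_left₀ (n := 4) (by norm_num) (kd_nonneg _ _) ?_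
      rw [kd_pow_four, kd_pow_four, hγ, hmul_hinv_segment]
      exact koranyiQuartic_smul_le hs.1 hs.2 _
    linarith
  exact hsub ⟨1, by simp, by simp [hγ]⟩

lemma measurePreserving_hmul_left (ζ : H1) : MeasurePreserving (hmul ζ) := by
  have h1 : MeasurePreserving (fun x : ℝ => ζ.1 + x) := measurePreserving_add_left volume _
  have h2 : ∀ a : ℝ, MeasurePreserving (fun q : ℝ × ℝ =>
      (ζ.2.1 + q.1, ζ.2.2 + q.2 + 2 * (a * ζ.2.1 - ζ.1 * q.1))) := by
    intro a
    refine MeasurePreserving.skew_product (μa := volume) (μb := volume) (μc := volume)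
      (μd := volume) (f := fun x => ζ.2.1 + x)
      (g := fun y t => ζ.2.2 + t + 2 * (a * ζ.2.1 - ζ.1 * y))
      (measurePreserving_add_left volume _) (by unfold Function.uncurry; fun_prop) ?_
    refine Filter.Eventually.of_forall fun y => ?_
    have := (measurePreserving_add_left (volume : Measure ℝ)
      (ζ.2.2 + 2 * (a * ζ.2.1 - ζ.1 * y))).map_eq
    convert this using 2
    ext t; ring
  refine MeasurePreserving.skew_product (μa := volume) (μb := volume) (μc := volume)
    (μd := volume) (f := fun x => ζ.1 + x)
    (g := fun x (q : ℝ × ℝ) => (ζ.2.1 + q.1, ζ.2.2 + q.2 + 2 * (x * ζ.2.1 - ζ.1 * q.1)))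
    h1 (by unfold Function.uncurry; fun_prop) ?_
  exact Filter.Eventually.of_forall fun a => (h2 a).map_eq

/-- Sublevel sets of the Koranyi gauge scale with homogeneous dimension four. -/
lemma volume_koranyiQuartic_lt_scale {l : ℝ} (hl : 0 < l) (s : ℝ) :
    volume {p : H1 | koranyiQuartic p < l ^ 4 * s}
      = ENNReal.ofReal (l ^ 4) * volume {p : H1 | koranyiQuartic p < s} := by
  set L : H1 →ₗ[ℝ] H1 := (l • LinearMap.id).prodMap ((l • LinearMap.id).prodMap
    (l ^ 2 • LinearMap.id)) with hL
  have hdet : LinearMap.det L = l ^ 4 := by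
    rw [hL, LinearMap.det_prodMap, LinearMap.det_prodMap, LinearMap.det_smul, LinearMap.det_smul]
    simp; ring
  have hpre : L ⁻¹' {p : H1 | koranyiQuartic p < l ^ 4 * s} = {p : H1 | koranyiQuartic p < s} := by
    ext p
    have : koranyiQuartic (L p) = l ^ 4 * koranyiQuartic p := by
      simp [hL, koranyiQuartic]; ring
    simp only [mem_preimage, mem_ofPred_eq, this]
    exact mul_lt_mul_iff_right₀ (by positivity)
  have hhaar : (volume : Measure H1).IsAddHaarMeasure := 
    Measure.prod.instIsAddHaarMeasure _ _
  have h := Measure.addHaar_preimage_linearMap volume (f := L) (by rw [hdet]; positivity)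
    {p : H1 | koranyiQuartic p < l ^ 4 * s}
  rw [hpre, hdet, abs_of_pos (by positivity)] at h
  rw [h, ← mul_assoc, ← ENNReal.ofReal_mul (by positivity), mul_inv_cancel₀ (by positivity)]
  simp

lemma volume_ball_scale (ζ : H1) {l : ℝ} (hl : 0 < l) (s : ℝ) :
    volume.real {p : H1 | koranyiQuartic (hmul ζ p) < l ^ 4 * s}
      = l ^ 4 * volume.real {p : H1 | koranyiQuartic (hmul ζ p) < s} := by
  have hc : Continuous koranyiQuartic := (contDiff_koranyiQuartic (n := 0)).continuous
  have h : ∀ r, volume {p : H1 | koranyiQuartic (hmul ζ p) < r}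
      = volume {p : H1 | koranyiQuartic p < r} := fun r =>
    (measurePreserving_hmul_left ζ).measure_preimage
      (isOpen_lt hc continuous_const).measurableSet.nullMeasurableSet
  rw [measureReal_def, measureReal_def, h, h, volume_koranyiQuartic_lt_scale hl, ENNReal.toReal_mul,
    ENNReal.toReal_ofReal (by positivity)]

/-- A smooth nonincreasing cut-off with controlled slope. -/
lemma exists_cutoff : ∃ g φ : ℝ → ℝ, ContDiff ℝ (⊤ : ℕ∞) g ∧ (∀ s, HasDerivAt g (-φ s) s) ∧
    (∀ s, φ s ^ 2 ≤ 1) ∧ (∀ s, s < 41 / 100 → φ s = 0) ∧ (∀ s, 99 / 100 < s → φ s = 0) ∧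
    (∀ s, 99 / 100 < s → g s = 0) ∧ (∀ s, s ≤ 41 / 100 → 54 / 100 ≤ g s) := by
  let b : ContDiffBump (7 / 10 : ℝ) := ⟨27 / 100, 29 / 100, by norm_num, by norm_num⟩
  have hb0 : ∀ s : ℝ, 29 / 100 ≤ |s - 7 / 10| → b s = 0 := fun s hs =>
    b.zero_of_le_dist (by rw [Real.dist_eq]; exact hs)
  have hint : ∀ u v : ℝ, IntervalIntegrable b volume u v := fun u v =>
    b.continuous.intervalIntegrable u v
  have hd : ∀ s, HasDerivAt (fun s => ∫ x in s..1, b x) (-b s) s := fun s =>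
    intervalIntegral.integral_hasDerivAt_left (hint s 1)
      b.continuous.aestronglyMeasurable.stronglyMeasurableAtFilter b.continuous.continuousAt
  refine ⟨fun s => ∫ x in s..1, b x, b, ?_, hd, ?_, ?_, ?_, ?_, ?_⟩
  · rw [contDiff_infty_iff_deriv]
    refine ⟨fun s => (hd s).differentiableAt, ?_⟩
    have : deriv (fun s => ∫ x in s..1, b x) = fun s => -b s := funext fun s => (hd s).deriv
    rw [this]
    exact b.contDiff.neg
  · exact fun s => pow_le_one₀ b.nonneg b.le_one
  · exact fun s hs => hb0 s (by rw [abs_of_neg] <;> linarith)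
  · exact fun s hs => hb0 s (by rw [abs_of_pos] <;> linarith)
  · intro s hs
    have : EqOn b (fun _ => 0) (uIcc s 1) := by
      intro x hx
      refine hb0 x ?_
      have : 99 / 100 < x := lt_of_lt_of_le (lt_min hs (by norm_num)) hx.1
      rw [abs_of_pos] <;> linarith
    simp only
    rw [intervalIntegral.integral_congr this]
    simp
  · intro s hs
    have h1 : (54 / 100 : ℝ) = ∫ x in (43 / 100 : ℝ)..(97 / 100), (1 : ℝ) := by norm_num
    have h2 : (∫ x in (43 / 100 : ℝ)..(97 / 100), (1 : ℝ)) = ∫ x in (43 / 100 : ℝ)..(97 / 100), b x := by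
      refine intervalIntegral.integral_congr fun x hx => ?_
      rw [uIcc_of_le (by norm_num)] at hx
      refine (b.one_of_mem_closedBall ?_).symm
      rw [Metric.mem_closedBall, Real.dist_eq, abs_le]
      change -(27 / 100) ≤ _ ∧ _ ≤ (27 / 100 : ℝ)
      constructor <;> linarith [hx.1, hx.2]
    rw [h1, h2]
    exact intervalIntegral.integral_mono_interval (by linarith) (by norm_num) (by norm_num)
      (Filter.Eventually.of_forall fun x => b.nonneg) (hint s 1)

/-- Horizontal gradient of a function of the Koranyi gauge. -/
lemma sq_horizontal_gradient_comp {g : ℝ → ℝ} {c : ℝ} (ζ : H1) (S : ℝ) {η : H1}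
    (hg : HasDerivAt g c (koranyiQuartic (hmul ζ η) / S)) :
    Xd (fun p => g (koranyiQuartic (hmul ζ p) / S)) η ^ 2
      + Yd (fun p => g (koranyiQuartic (hmul ζ p) / S)) η ^ 2
      = c ^ 2 * (16 * ((hmul ζ η).1 ^ 2 + (hmul ζ η).2.1 ^ 2) * koranyiQuartic (hmul ζ η)) / S ^ 2 := by
  set u : H1 → ℝ := fun p => koranyiQuartic (hmul ζ p) with hu
  have hdu : DifferentiableAt ℝ u η :=
    ((contDiff_koranyiQuartic (n := 1)).comp (contDiff_hmul_left ζ)).differentiable (by simp) η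
  have hf : HasFDerivAt (fun p => g (u p / S)) ((c * S⁻¹) • fderiv ℝ u η) η := by
    have h1 : HasFDerivAt (fun p => u p / S) (S⁻¹ • fderiv ℝ u η) η := by
      simpa [div_eq_mul_inv] using hdu.hasFDerivAt.mul_const S⁻¹
    have := hg.comp_hasFDerivAt η h1
    rwa [smul_smul] at this
  have key : ∀ w : H1, fderiv ℝ u η w =
      2 * ((hmul ζ η).1 ^ 2 + (hmul ζ η).2.1 ^ 2) *
          (2 * (hmul ζ η).1 * w.1 + 2 * (hmul ζ η).2.1 * w.2.1)
        + 2 * (hmul ζ η).2.2 * (w.2.2 + 2 * (w.1 * ζ.2.1 - ζ.1 * w.2.1)) := by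
    intro w
    have hγ : HasDerivAt (fun s : ℝ => η + s • w) w 0 := by
      simpa using ((hasDerivAt_id (0 : ℝ)).smul_const w).const_add η
    have hl : HasFDerivAt u (fderiv ℝ u η) (η + (0 : ℝ) • w) := by simpa using hdu.hasFDerivAt
    have h1 := hl.comp_hasDerivAt 0 hγ
    have hA : HasDerivAt (fun s : ℝ => (hmul ζ η).1 + s * w.1) w.1 0 := by
      simpa using ((hasDerivAt_id (0 : ℝ)).mul_const w.1).const_add (hmul ζ η).1
    have hB : HasDerivAt (fun s : ℝ => (hmul ζ η).2.1 + s * w.2.1) w.2.1 0 := by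
      simpa using ((hasDerivAt_id (0 : ℝ)).mul_const w.2.1).const_add (hmul ζ η).2.1
    have hC : HasDerivAt (fun s : ℝ => (hmul ζ η).2.2 + s * (w.2.2 + 2 * (w.1 * ζ.2.1 - ζ.1 * w.2.1)))
        (w.2.2 + 2 * (w.1 * ζ.2.1 - ζ.1 * w.2.1)) 0 := by
      simpa using ((hasDerivAt_id (0 : ℝ)).mul_const
        (w.2.2 + 2 * (w.1 * ζ.2.1 - ζ.1 * w.2.1))).const_add (hmul ζ η).2.2
    have h2 := (((hA.pow 2).add (hB.pow 2)).pow 2).add (hC.pow 2)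
    have heq : (u ∘ fun s : ℝ => η + s • w) = fun s : ℝ =>
        (((hmul ζ η).1 + s * w.1) ^ 2 + ((hmul ζ η).2.1 + s * w.2.1) ^ 2) ^ 2
          + ((hmul ζ η).2.2 + s * (w.2.2 + 2 * (w.1 * ζ.2.1 - ζ.1 * w.2.1))) ^ 2 := by
      funext s
      simp only [hu, koranyiQuartic, hmul, Function.comp, Prod.fst_add, Prod.snd_add,
        Prod.smul_fst, Prod.smul_snd, smul_eq_mul]
      ring
    rw [heq] at h1
    rw [h1.unique h2]
    simp
  have hX : Xd (fun p => g (u p / S)) η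
      = c * S⁻¹ * (4 * ((hmul ζ η).1 ^ 2 + (hmul ζ η).2.1 ^ 2) * (hmul ζ η).1
        + 4 * (hmul ζ η).2.2 * (hmul ζ η).2.1) := by
    rw [Xd, hf.fderiv, _root_.smul_apply, key]
    simp only [hmul, smul_eq_mul]; ring
  have hY : Yd (fun p => g (u p / S)) η
      = c * S⁻¹ * (4 * ((hmul ζ η).1 ^ 2 + (hmul ζ η).2.1 ^ 2) * (hmul ζ η).2.1
        - 4 * (hmul ζ η).2.2 * (hmul ζ η).1) := by
    rw [Yd, hf.fderiv, _root_.smul_apply, key]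
    simp only [hmul, smul_eq_mul]; ring
  rw [hX, hY, koranyiQuartic, div_eq_mul_inv, ← inv_pow]
  ring

/-- Upper bound for the first eigenvalue of a domain containing a Koranyi ball. -/
lemma lam1_le_of_kball_subset {Ω : Set H1} (hΩb : Bornology.IsBounded Ω) {ξ : H1}
    {R : ℝ} (hR : 0 < R) (hball : ∀ η, kd ξ η < R → η ∈ Ω) : lam1 Ω ≤ 80 / R ^ 2 := by
  obtain ⟨g, φ, hgs, hgd, hφ1, hφa, hφb, hgb, hga⟩ := exists_cutoff
  set ζ := hinv ξ with hζ
  set u : H1 → ℝ := fun p => koranyiQuartic (hmul ζ p) with hu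
  have hus : ContDiff ℝ (⊤ : ℕ∞) u := contDiff_koranyiQuartic.comp (contDiff_hmul_left ζ)
  have huc : Continuous u := hus.continuous
  have hmem : ∀ p, u p < R ^ 4 → p ∈ Ω := by
    intro p hp
    refine hball p ?_
    have : kd ξ p ^ 4 < R ^ 4 := by rwa [kd_pow_four]
    exact lt_of_pow_lt_pow_left₀ 4 hR.le this
  have hR4 : 0 < R ^ 4 := by positivity
  set v : H1 → ℝ := fun p => g (u p / R ^ 4) with hv
  have hvs : ContDiff ℝ (⊤ : ℕ∞) v := hgs.comp (hus.div_const _)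
  have huξ : u ξ = 0 := by simp [hu, hζ, koranyiQuartic, hmul, hinv]
  have hts : tsupport v ⊆ {p | u p ≤ 99 / 100 * R ^ 4} := by
    refine closure_minimal ?_ (isClosed_le huc continuous_const)
    intro p hp
    by_contra hn
    refine hp (hgb _ ?_)
    rw [mem_ofPred_eq, not_le] at hn
    rwa [lt_div_iff₀ hR4]
  have htsΩ : tsupport v ⊆ Ω := fun p hp => hmem p (by
    have : u p ≤ 99 / 100 * R ^ 4 := hts hp
    linarith)
  have hcs : HasCompactSupport v :=
    hΩb.isCompact_closure.of_isClosed_subset (isClosed_tsupport v) (htsΩ.trans subset_closure)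
  have hv0 : v ≠ 0 := by
    intro h
    have h1 : v ξ = 0 := by rw [h]; rfl
    have h2 := hga 0 (by norm_num)
    simp only [hv, huξ, zero_div] at h1
    linarith
  have hfin : volume {p | u p < R ^ 4} ≠ ⊤ :=
    (hΩb.subset fun p hp => hmem p hp).measure_lt_top.ne
  set V := volume.real {p | u p < R ^ 4} with hV
  have hVpos : 0 < V := by
    rw [hV, measureReal_def]
    refine ENNReal.toReal_pos ?_ hfin
    exact ((isOpen_lt huc continuous_const).measure_pos volume ⟨ξ, by simpa [huξ] using hR4⟩).ne'
  have hVa : volume.real {p | u p < (4 / 5) ^ 4 * R ^ 4} = (4 / 5) ^ 4 * V :=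
    volume_ball_scale ζ (by norm_num) _
  set A : Set H1 := {p | u p < R ^ 4} \ {p | u p < (4 / 5) ^ 4 * R ^ 4} with hA
  have hmeas : ∀ r, MeasurableSet {p | u p < r} := fun r =>
    (isOpen_lt huc continuous_const).measurableSet
  have hsub : {p | u p < (4 / 5) ^ 4 * R ^ 4} ⊆ {p | u p < R ^ 4} := fun p hp => by
    have hp : u p < (4 / 5) ^ 4 * R ^ 4 := hp
    change u p < R ^ 4
    linarith
  have hVA : volume.real A = (1 - (4 / 5) ^ 4) * V := by
    rw [hA, measureReal_sdiff hsub (hmeas _) hfin, hVa, ← hV]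
    ring
  have hAfin : volume A ≠ ⊤ := ne_top_of_le_ne_top hfin (measure_mono sdiff_subset)
  have hAΩ : A ∩ Ω = A := inter_eq_left.2 fun p hp => hmem p hp.1
  have hnum : ∫ η in Ω, (Xd v η ^ 2 + Yd v η ^ 2) ≤ 16 / R ^ 2 * ((1 - (4 / 5) ^ 4) * V) := by
    have hpt : ∀ η, Xd v η ^ 2 + Yd v η ^ 2 ≤ A.indicator (fun _ => 16 / R ^ 2) η := by
      intro η
      rw [sq_horizontal_gradient_comp ζ (R ^ 4) (hgd _)]
      by_cases hη : η ∈ A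
      · rw [indicator_of_mem hη]
        set z := (hmul ζ η).1 ^ 2 + (hmul ζ η).2.1 ^ 2 with hz
        have hz0 : 0 ≤ z := by positivity
        have hzu : z ^ 2 ≤ u η := by
          simp only [hu, koranyiQuartic, ← hz]; nlinarith [sq_nonneg (hmul ζ η).2.2]
        have huR : u η < R ^ 4 := hη.1
        have hzR : z ≤ R ^ 2 :=
          le_of_pow_le_pow_left₀ (n := 2) (by norm_num) (by positivity)
            (by rw [← pow_mul]; exact hzu.trans huR.le)
        have hu0 : 0 ≤ u η := koranyiQuartic_nonneg _
        rw [div_le_div_iff₀ (by positivity) (by positivity)]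
        change (-φ (u η / R ^ 4)) ^ 2 * (16 * z * u η) * R ^ 2 ≤ _
        have h1 : z * u η ≤ R ^ 2 * R ^ 4 := mul_le_mul hzR huR.le hu0 (by positivity)
        have h2 : φ (u η / R ^ 4) ^ 2 * (z * u η) ≤ 1 * (R ^ 2 * R ^ 4) :=
          mul_le_mul (hφ1 _) h1 (by positivity) (by norm_num)
        have h3 := mul_le_mul_of_nonneg_right h2 (sq_nonneg R)
        nlinarith
      · rw [indicator_of_notMem hη]
        have : φ (koranyiQuartic (hmul ζ η) / R ^ 4) = 0 := by
          by_cases h1 : u η < R ^ 4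
          · have h2 : u η < (4 / 5) ^ 4 * R ^ 4 := by
              by_contra h2
              exact hη ⟨h1, h2⟩
            refine hφa _ ?_
            rw [div_lt_iff₀ hR4]
            change u η < _
            linarith
          · refine hφb _ ?_
            rw [lt_div_iff₀ hR4]
            change _ < u η
            linarith
        simp [this]
    have hAm : MeasurableSet A := (hmeas _).diff (hmeas _)
    have hi : Integrable (A.indicator fun _ : H1 => 16 / R ^ 2) (volume.restrict Ω) :=
      (integrable_indicator_iff hAm).2 (integrableOn_const
        (ne_top_of_le_ne_top hAfin (Measure.restrict_apply_le _ _)))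
    refine (integral_mono_of_nonneg (Filter.Eventually.of_forall fun η => by positivity) hi
      (Filter.Eventually.of_forall hpt)).trans (le_of_eq ?_)
    rw [integral_indicator hAm, setIntegral_const, smul_eq_mul, measureReal_restrict_apply hAm,
      hAΩ, hVA]
    ring
  have hden : (54 / 100) ^ 2 * ((4 / 5) ^ 4 * V) ≤ ∫ η in Ω, v η ^ 2 := by
    have hcs2 : HasCompactSupport (fun η => v η ^ 2) :=
      hcs.comp_left (g := fun x : ℝ => x ^ 2) (by norm_num)
    have hc2 : Continuous fun η => v η ^ 2 := hvs.continuous.pow 2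
    have hi0 : Integrable (fun η => v η ^ 2) := hc2.integrable_of_hasCompactSupport hcs2
    have hi : Integrable (fun η => v η ^ 2) (volume.restrict Ω) := hi0.restrict
    have hsubΩ : {p | u p < (4 / 5) ^ 4 * R ^ 4} ∩ Ω = {p | u p < (4 / 5) ^ 4 * R ^ 4} :=
      by
      refine inter_eq_left.2 fun p hp => ?_
      have hp' : u p < R ^ 4 := hsub hp
      exact hmem p hp'
    have : ∫ η in Ω, {p | u p < (4 / 5) ^ 4 * R ^ 4}.indicator (fun _ => (54 / 100 : ℝ) ^ 2) η
        ≤ ∫ η in Ω, v η ^ 2 := by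
      refine integral_mono_of_nonneg (Filter.Eventually.of_forall fun η =>
        indicator_nonneg (fun _ _ => by norm_num) _) hi (Filter.Eventually.of_forall fun η => ?_)
      refine indicator_le' (fun p hp => ?_) (fun p _ => sq_nonneg _) η
      have hp : u p < (4 / 5) ^ 4 * R ^ 4 := hp
      refine pow_le_pow_left₀ (by norm_num) (hga _ ?_) 2
      rw [div_le_iff₀ hR4]
      linarith
    rwa [integral_indicator (hmeas _), setIntegral_const, smul_eq_mul,
      measureReal_restrict_apply (hmeas _), hsubΩ, hVa, mul_comm] at this
  have hle : lam1 Ω ≤ (∫ η in Ω, ((Xd v η) ^ 2 + (Yd v η) ^ 2)) / (∫ η in Ω, (v η) ^ 2) := by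
    refine csInf_le ⟨0, ?_⟩ ⟨v, hvs, hcs, htsΩ, hv0, rfl⟩
    rintro _ ⟨w, -, -, -, -, rfl⟩
    exact div_nonneg (integral_nonneg fun _ => by positivity) (integral_nonneg fun _ => by positivity)
  have hdpos : 0 < ∫ η in Ω, v η ^ 2 := lt_of_lt_of_le (by positivity) hden
  refine hle.trans ?_
  rw [div_le_iff₀ hdpos]
  have h1 := mul_le_mul_of_nonneg_left hden (show (0 : ℝ) ≤ 80 / R ^ 2 by positivity)
  have h2 : 16 / R ^ 2 * ((1 - (4 / 5) ^ 4) * V)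
      ≤ 80 / R ^ 2 * ((54 / 100) ^ 2 * ((4 / 5) ^ 4 * V)) := by
    have : (0 : ℝ) ≤ V / R ^ 2 := by positivity
    have e1 : 16 / R ^ 2 * ((1 - (4 / 5) ^ 4) * V) = (16 * (1 - (4 / 5) ^ 4)) * (V / R ^ 2) := by ring
    have e2 : 80 / R ^ 2 * ((54 / 100) ^ 2 * ((4 / 5) ^ 4 * V))
        = (80 * ((54 / 100) ^ 2 * (4 / 5) ^ 4)) * (V / R ^ 2) := by ring
    rw [e1, e2]
    exact mul_le_mul_of_nonneg_right (by norm_num) this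
  linarith

/-- Main theorem: λ₁(Ω) ≤ C_Ω(ξ)·l₁₁²/r_Ω(ξ)², where
C_Ω(ξ) = 16√2·α_Ω(ξ)⁶·√(3/(2π)) and l₁₁ is the smallest strictly positive
zero of the Bessel function J₁. -/
theorem first_eigenvalue_upper_bound (Ω : Set H1) (hΩo : IsOpen Ω)
    (hΩb : Bornology.IsBounded Ω) (hsm : smoothBdry Ω)
    (hu1 : uebp Ω) (hu2 : uebp (Set.univ \ closure Ω))
    (ξ : H1) (hξ : ξ ∈ Ω) (H : H1 → ℝ)
    (hHc : ContinuousOn H (closure Ω)) (hHd : ContDiffOn ℝ 2 H Ω)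
    (hHh : ∀ η ∈ Ω, kohn H η = 0)
    (hHb : ∀ η ∈ frontier Ω, H η = Γξ ξ η)
    (hHξ : 0 < H ξ)
    (l11 : ℝ) (hl11pos : 0 < l11) (hl11zero : J1 l11 = 0)
    (hl11min : ∀ l : ℝ, 0 < l → J1 l = 0 → l11 ≤ l) :
    let r : ℝ := 1 / Real.sqrt (8 * π * H ξ)
    let α : ℝ := sSup (kd ξ '' frontier Ω) / sInf (kd ξ '' frontier Ω)
    lam1 Ω ≤ (16 * Real.sqrt 2 * α ^ 6 * Real.sqrt (3 / (2 * π))) * l11 ^ 2 / r ^ 2 := by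
  intro r α
  have hcpt : IsCompact (closure Ω) := hΩb.isCompact_closure
  have hfc : IsCompact (frontier Ω) :=
    hcpt.of_isClosed_subset isClosed_frontier frontier_subset_closure
  have hfne : (frontier Ω).Nonempty := by
    refine nonempty_frontier_iff.2 ⟨⟨ξ, hξ⟩, fun h => ?_⟩
    exact NormedSpace.unbounded_univ ℝ H1 (h ▸ hΩb)
  have hic : IsCompact (kd ξ '' frontier Ω) := hfc.image (continuous_kd ξ)
  set R := sInf (kd ξ '' frontier Ω) with hR
  set M := sSup (kd ξ '' frontier Ω) with hM
  have hRle : ∀ η ∈ frontier Ω, R ≤ kd ξ η := fun η hη =>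
    csInf_le hic.bddBelow (mem_image_of_mem _ hη)
  have hMle : ∀ η ∈ frontier Ω, kd ξ η ≤ M := fun η hη =>
    le_csSup hic.bddAbove (mem_image_of_mem _ hη)
  have hξf : ∀ η ∈ frontier Ω, η ≠ ξ := by
    rintro η hη rfl
    exact hη.2 (by rwa [hΩo.interior_eq])
  have hRpos : 0 < R := by
    obtain ⟨η, hη, hηR⟩ := hic.sInf_mem (hfne.image _)
    rw [hR, ← hηR]
    exact kd_pos (hξf η hη)
  have hRM : R ≤ M := by
    obtain ⟨η, hη⟩ := hfne
    exact (hRle η hη).trans (hMle η hη)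
  have hMpos : 0 < M := hRpos.trans_le hRM
  have hHlow : 1 / (8 * π * M ^ 2) ≤ H ξ := by
    refine kohn_min_principle hΩo hΩb hHc hHd hHh (fun η hη => ?_) hξ
    rw [hHb η hη, Γξ]
    have hk := kd_pos (hξf η hη)
    have := hMle η hη
    gcongr
  have hlam := lam1_le_of_kball_subset hΩb hRpos
    (fun η hη => mem_of_kd_lt hΩo hξ hRle hη)
  have hl6 : 6 ≤ l11 ^ 2 := by
    by_contra! h
    exact (J1_pos hl11pos h).ne' hl11zero
  have hα1 : 1 ≤ α := (one_le_div hRpos).2 hRM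
  have hr : r ^ 2 = 1 / (8 * π * H ξ) := by
    simp only [r]
    rw [div_pow, Real.sq_sqrt (by positivity), one_pow]
  have hrinv : 1 / M ^ 2 ≤ 1 / r ^ 2 := by
    rw [hr, one_div_one_div]
    have h1 := mul_le_mul_of_nonneg_left hHlow (show 0 ≤ 8 * π by positivity)
    have h2 : 8 * π * (1 / (8 * π * M ^ 2)) = 1 / M ^ 2 := by field_simp
    linarith
  have hconst : 15 ≤ 16 * Real.sqrt 2 * Real.sqrt (3 / (2 * π)) := by
    rw [mul_assoc, ← Real.sqrt_mul (by norm_num)]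
    have : (15 / 16 : ℝ) ≤ Real.sqrt (2 * (3 / (2 * π))) := by
      refine Real.le_sqrt_of_sq_le ?_
      rw [show 2 * (3 / (2 * π)) = 3 / π by field_simp, le_div_iff₀ Real.pi_pos]
      nlinarith [Real.pi_lt_d2]
    linarith
  have hα : 1 / R ^ 2 ≤ α ^ 6 * (1 / r ^ 2) := by
    have h1 : 1 / R ^ 2 = α ^ 2 * (1 / M ^ 2) := by
      have hαe : α = M / R := rfl
      rw [hαe]
      field_simp
    rw [h1]
    exact mul_le_mul (pow_le_pow_right₀ hα1 (by norm_num)) hrinv (by positivity) (by positivity)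
  calc lam1 Ω ≤ 80 / R ^ 2 := hlam
    _ ≤ 15 * 6 * (1 / R ^ 2) := by
        rw [div_eq_mul_one_div]
        exact mul_le_mul_of_nonneg_right (by norm_num) (by positivity)
    _ ≤ (16 * Real.sqrt 2 * Real.sqrt (3 / (2 * π))) * l11 ^ 2 * (α ^ 6 * (1 / r ^ 2)) := by
        gcongr
    _ = _ := by ring
end
end
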